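/- Let r ∈ ℕ and assume that c₁ − r is also not a nonpositive integer. For every real x > 0 and every y ∈ ℂ, the r-th derivative at x of the complex-valued function s ↦ s^{c₁−1} · 𝓕₂⁽¹⁾(a,b₁,b₂;c₁,c₂;t₁,t₂,k₁,k₂,s,y) on (0,∞) (complex powers of s via the real logarithm) equals (−1)^r (1 − c₁)_r x^{c₁−r−1} · 𝓕₂⁽¹⁾(a, b₁, b₂; c₁ − r, c₂; t₁, t₂, k₁, k₂, x, y). -/

import Mathlib

open Complex Finset

/-- Ascending Pochhammer symbol `(z)_j = z (z+1) ⋯ (z+j−1)`, with `(z)_0 = 1`. -/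
noncomputable def poch (z : ℂ) (j : ℕ) : ℂ := (ascPochhammer ℂ j).eval z

/-- The first discrete Appell function `𝓕₂⁽¹⁾(a,b₁,b₂;c₁,c₂;t₁,t₂,k₁,k₂,x,y)`.
Since `(−t₁)_{m k₁} = 0` once `m k₁ > t₁` and `(−t₂)_{n k₂} = 0` once `n k₂ > t₂`
(for `k₁, k₂ ≥ 1`), the doubly infinite sum reduces to this finite sum. -/
noncomputable def F2one (a b₁ b₂ c₁ c₂ : ℂ) (t₁ t₂ k₁ k₂ : ℕ) (x y : ℂ) : ℂ :=
  ∑ m ∈ Finset.range (t₁ + 1), ∑ n ∈ Finset.range (t₂ + 1),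
    poch a (m + n) * poch b₁ m * poch b₂ n * (-1 : ℂ) ^ (m * k₁) * poch (-(t₁ : ℂ)) (m * k₁)
      * (-1 : ℂ) ^ (n * k₂) * poch (-(t₂ : ℂ)) (n * k₂) * x ^ m * y ^ n
    / (poch c₁ m * poch c₂ n * (Nat.factorial m : ℂ) * (Nat.factorial n : ℂ))

lemma poch_succ (z : ℂ) (j : ℕ) : poch z (j + 1) = poch z j * (z + j) := by
  simp [poch, ascPochhammer_succ_right]

lemma poch_succ_left (z : ℂ) (j : ℕ) : poch z (j + 1) = z * poch (z + 1) j := by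
  simp [poch, ascPochhammer_succ_left]

lemma poch_ne_zero {z : ℂ} (hz : ∀ n : ℕ, z ≠ -(n : ℂ)) (j : ℕ) : poch z j ≠ 0 := by
  induction j with
  | zero => simp [poch]
  | succ j ih =>
    rw [poch_succ]
    exact mul_ne_zero ih fun h => hz j (eq_neg_of_add_eq_zero_left h)

lemma poch_ratio {c : ℂ} (hc : ∀ n : ℕ, c ≠ -(n : ℂ)) (hc' : ∀ n : ℕ, c - 1 ≠ -(n : ℂ))
    (m : ℕ) : (c - 1 + m) / poch c m = (c - 1) / poch (c - 1) m := by
  have h := poch_succ (c - 1) m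
  rw [poch_succ_left, sub_add_cancel] at h
  rw [div_eq_div_iff (poch_ne_zero hc m) (poch_ne_zero hc' m), h, mul_comm]

lemma hasDerivAt_ofReal_cpow_mul_pow (c : ℂ) (m : ℕ) {x : ℝ} (hx : 0 < x) :
    HasDerivAt (fun s : ℝ => (s : ℂ) ^ (c - 1) * (s : ℂ) ^ m)
      ((c - 1 + m) * ((x : ℂ) ^ (c - 1 - 1) * (x : ℂ) ^ m)) x := by
  have hx0 : (x : ℂ) ≠ 0 := Complex.ofReal_ne_zero.mpr hx.ne'
  have h₁ : HasDerivAt (fun z : ℂ => z ^ (c - 1)) ((c - 1) * (x : ℂ) ^ (c - 1 - 1)) x :=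
    (Complex.hasStrictDerivAt_cpow_const (Complex.ofReal_mem_slitPlane.mpr hx)).hasDerivAt
  refine ((h₁.mul (hasDerivAt_pow m (x : ℂ))).comp_ofReal).congr_deriv ?_
  rw [Complex.cpow_sub (c - 1) 1 hx0, Complex.cpow_one]
  cases m with
  | zero => simp
  | succ m =>
    rw [Nat.add_sub_cancel]
    field_simp
    ring

/-- The case `r = 1` of the differential formula. -/
lemma hasDerivAt_cpow_mul_F2one (a b₁ b₂ c c₂ : ℂ) (t₁ t₂ k₁ k₂ : ℕ)
    (hc : ∀ n : ℕ, c ≠ -(n : ℂ)) (hc' : ∀ n : ℕ, c - 1 ≠ -(n : ℂ))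
    {x : ℝ} (hx : 0 < x) (y : ℂ) :
    HasDerivAt (fun s : ℝ => (s : ℂ) ^ (c - 1) * F2one a b₁ b₂ c c₂ t₁ t₂ k₁ k₂ (s : ℂ) y)
      ((c - 1) * ((x : ℂ) ^ (c - 1 - 1) * F2one a b₁ b₂ (c - 1) c₂ t₁ t₂ k₁ k₂ (x : ℂ) y)) x := by
  simp only [F2one, Finset.mul_sum]
  refine HasDerivAt.fun_sum fun m _ => HasDerivAt.fun_sum fun n _ => ?_
  have h := (hasDerivAt_ofReal_cpow_mul_pow c m hx).const_mul
    (poch a (m + n) * poch b₁ m * poch b₂ n * (-1 : ℂ) ^ (m * k₁) * poch (-(t₁ : ℂ)) (m * k₁)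
      * (-1 : ℂ) ^ (n * k₂) * poch (-(t₂ : ℂ)) (n * k₂) * y ^ n
      / (poch c₂ n * (Nat.factorial m : ℂ) * (Nat.factorial n : ℂ)) / poch c m)
  refine (h.congr_deriv ?_).congr_of_eventuallyEq (.of_forall fun s => ?_)
  · rw [div_mul_eq_mul_div, ← mul_assoc, mul_comm _ (c - 1 + (m : ℂ)), mul_assoc, mul_assoc,
      ← div_mul_eq_mul_div, poch_ratio hc hc']
    simp only [div_eq_mul_inv, mul_inv]
    ring
  · simp only [div_eq_mul_inv, mul_inv]
    ring

/-- The differential formula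
`(∂/∂x)^r [x^{c₁−1} 𝓕₂⁽¹⁾(a,b₁,b₂;c₁,c₂;t₁,t₂,k₁,k₂,x,y)]
  = (−1)^r (1−c₁)_r x^{c₁−r−1} 𝓕₂⁽¹⁾(a, b₁, b₂; c₁−r, c₂; t₁, t₂, k₁, k₂, x, y)`
at real `x > 0`, complex powers of the positive real variable via the real logarithm. -/
theorem deriv_pow_c1_formula (a b₁ b₂ c₁ c₂ : ℂ) (k₁ k₂ : ℕ)
    (hk₁ : 0 < k₁) (hk₂ : 0 < k₂)
    (hc₁ : ∀ n : ℕ, c₁ ≠ -(n : ℂ)) (hc₂ : ∀ n : ℕ, c₂ ≠ -(n : ℂ))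
    (t₁ t₂ : ℕ) (r : ℕ) (hc₁r : ∀ n : ℕ, c₁ - (r : ℂ) ≠ -(n : ℂ))
    (x : ℝ) (hx : 0 < x) (y : ℂ) :
    iteratedDeriv r
        (fun s : ℝ => (s : ℂ) ^ (c₁ - 1) * F2one a b₁ b₂ c₁ c₂ t₁ t₂ k₁ k₂ (s : ℂ) y)
        x =
      (-1 : ℂ) ^ r * poch (1 - c₁) r * (x : ℂ) ^ (c₁ - (r : ℂ) - 1) *
        F2one a b₁ b₂ (c₁ - (r : ℂ)) c₂ t₁ t₂ k₁ k₂ (x : ℂ) y := by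
  induction r generalizing x with
  | zero => simp [poch]
  | succ r ih =>
    have hr : ∀ n : ℕ, c₁ - (r : ℂ) ≠ -(n : ℂ) := fun n h =>
      hc₁r (n + 1) (by push_cast; linear_combination h)
    have hr' : ∀ n : ℕ, c₁ - (r : ℂ) - 1 ≠ -(n : ℂ) := fun n h =>
      hc₁r n (by push_cast; linear_combination h)
    have hd := (hasDerivAt_cpow_mul_F2one a b₁ b₂ (c₁ - r) c₂ t₁ t₂ k₁ k₂ hr hr' hx y).const_mul
      ((-1 : ℂ) ^ r * poch (1 - c₁) r)
    rw [iteratedDeriv_succ, (hd.congr_of_eventuallyEq ?_).deriv]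
    · rw [poch_succ, Nat.cast_succ, ← sub_sub]
      ring
    · filter_upwards [lt_mem_nhds hx] with s hs
      rw [ih hr s hs, mul_assoc]
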